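/- (Corollary 3, ZeroSARAH with improved initial minibatch.) Suppose n ≥ 2 is a perfect square, f is bounded below with f* := inf_x f(x), and G_0 := (1/n)∑_{i=1}^n ‖∇f_i(x⁰)‖² > 0. Fix ε > 0. Run ZeroSARAH with constant stepsize η_k = η := 1/((1+√8)L), minibatch sizes b_k = √n for k ≥ 1 and b_0 = min{⌈√(n G_0)/ε⌉, n}, and parameters λ_0 = 1, λ_k = 1/(2√n) for k ≥ 1. Then for every K ≥ 1, (1/K) ∑_{k=0}^{K−1} E[‖∇f(x^k)‖²] ≤ (2(1+√8)L(f(x⁰) − f*) + 6(n − b_0)G_0/(√n b_0))/K. Consequently, there exists K ≥ 1 such that (1/K)∑_{k<K}E[‖∇f(x^k)‖²] ≤ ε² and the total number of stochastic gradient computations b_0 + (K−1)√n is at most √n·(2(1+√8)L(f(x⁰) − f*)/ε² + min{7√G_0/ε, √n}) + 2√n. -/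

import Mathlib

noncomputable section

/-- The average function `f = (1/n) ∑ᵢ fᵢ`. -/
noncomputable def avgF {d n : ℕ} (f : Fin n → EuclideanSpace ℝ (Fin d) → ℝ) :
    EuclideanSpace ℝ (Fin d) → ℝ :=
  fun z => (n : ℝ)⁻¹ * ∑ i, f i z

/-- The ZeroSARAH random process.  Given a draw `ω : ℕ → Finset (Fin n)` of minibatches,
`zsState f η lam b x0 ω k = (xᵏ, xᵏ⁻¹, vᵏ⁻¹, y^{k−1})`, with
`x⁻¹ = x⁰`, `v⁻¹ = 0`, `y⁻¹ = 0`, and at each step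
`vᵏ = (1/bₖ)∑_{i∈Iₖ}(∇fᵢ(xᵏ) − ∇fᵢ(xᵏ⁻¹)) + (1−λₖ)vᵏ⁻¹
     + λₖ[(1/bₖ)∑_{i∈Iₖ}(∇fᵢ(xᵏ⁻¹) − yᵢᵏ⁻¹) + (1/n)∑ⱼ yⱼᵏ⁻¹]`,
`xᵏ⁺¹ = xᵏ − ηₖ vᵏ`, `yᵢᵏ = ∇fᵢ(xᵏ)` for `i ∈ Iₖ`, `yᵢᵏ = yᵢᵏ⁻¹` otherwise. -/
noncomputable def zsState {d n : ℕ} (f : Fin n → EuclideanSpace ℝ (Fin d) → ℝ)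
    (η lam : ℕ → ℝ) (b : ℕ → ℕ) (x0 : EuclideanSpace ℝ (Fin d))
    (ω : ℕ → Finset (Fin n)) :
    ℕ → EuclideanSpace ℝ (Fin d) × EuclideanSpace ℝ (Fin d) ×
      EuclideanSpace ℝ (Fin d) × (Fin n → EuclideanSpace ℝ (Fin d))
  | 0 => (x0, x0, 0, fun _ => 0)
  | (k + 1) =>
      let st := zsState f η lam b x0 ω k
      let v : EuclideanSpace ℝ (Fin d) :=
        (b k : ℝ)⁻¹ • ∑ i ∈ ω k, (gradient (f i) st.1 - gradient (f i) st.2.1)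
          + (1 - lam k) • st.2.2.1
          + lam k • ((b k : ℝ)⁻¹ • ∑ i ∈ ω k, (gradient (f i) st.2.1 - st.2.2.2 i)
              + (n : ℝ)⁻¹ • ∑ j, st.2.2.2 j)
      (st.1 - η k • v, st.1, v,
        fun i => if i ∈ ω k then gradient (f i) st.1 else st.2.2.2 i)

/-- Expectation over the first `k` independent uniformly random minibatches
`I₀, …, I_{k−1}` with `|Iⱼ| = bⱼ`, of a functional of the whole draw. -/
noncomputable def zsExpK {n : ℕ} (b : ℕ → ℕ) (k : ℕ)
    (g : (ℕ → Finset (Fin n)) → ℝ) : ℝ :=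
  (∑ τ ∈ Finset.univ.filter
      (fun τ : Fin k → Finset (Fin n) => ∀ j : Fin k, (τ j).card = b j.val),
    g (fun j => if h : j < k then τ ⟨j, h⟩ else ∅)) /
  ((Finset.univ.filter
      (fun τ : Fin k → Finset (Fin n) => ∀ j : Fin k, (τ j).card = b j.val)).card : ℝ)

/-- Average over all minibatches of size `m`. -/
def avI {n : ℕ} (m : ℕ) (φ : Finset (Fin n) → ℝ) : ℝ :=
  (∑ I ∈ Finset.powersetCard m Finset.univ, φ I) / (n.choose m : ℝ)

theorem avI_mono {n m : ℕ} {φ ψ : Finset (Fin n) → ℝ} (h : ∀ I, I.card = m → φ I ≤ ψ I) :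
    avI m φ ≤ avI m ψ := by
  unfold avI
  apply div_le_div_of_nonneg_right _ (by positivity)
  apply Finset.sum_le_sum
  intro I hI
  exact h I (by simpa using hI)

theorem avI_add {n m : ℕ} (φ ψ : Finset (Fin n) → ℝ) :
    avI m (fun I => φ I + ψ I) = avI m φ + avI m ψ := by
  unfold avI
  rw [Finset.sum_add_distrib, add_div]

theorem avI_smul {n m : ℕ} (c : ℝ) (φ : Finset (Fin n) → ℝ) :
    avI m (fun I => c * φ I) = c * avI m φ := by
  unfold avI
  rw [← Finset.mul_sum, mul_div_assoc]

theorem avI_const {n m : ℕ} (hm : m ≤ n) (c : ℝ) :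
    avI m (fun _ : Finset (Fin n) => c) = c := by
  unfold avI
  have : (n.choose m : ℝ) ≠ 0 := by
    exact_mod_cast (Nat.choose_pos hm).ne'
  simp [Finset.card_powersetCard]
  field_simp

theorem avI_sum {n m : ℕ} {ι : Type*} (s : Finset ι) (φ : ι → Finset (Fin n) → ℝ) :
    avI m (fun I => ∑ i ∈ s, φ i I) = ∑ i ∈ s, avI m (φ i) := by
  unfold avI
  rw [Finset.sum_comm, Finset.sum_div]

theorem avI_mem {n m : ℕ} (hm1 : 1 ≤ m) (hm : m ≤ n) (i : Fin n) :
    avI m (fun I => if i ∈ I then (1 : ℝ) else 0) = (m : ℝ) / n := by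
  unfold avI
  rw [Finset.sum_boole]
  have h := Finset.card_filter_powersetCard_subset {i} (Finset.univ : Finset (Fin n)) m
    (by simp) (by simpa using hm1)
  simp only [Finset.singleton_subset_iff, Finset.card_univ, Fintype.card_fin,
    Finset.card_singleton] at h
  rw [h]
  obtain ⟨n, rfl⟩ : ∃ k, n = k + 1 := ⟨n - 1, by omega⟩
  obtain ⟨m, rfl⟩ : ∃ k, m = k + 1 := ⟨m - 1, by omega⟩
  have h2 := Nat.add_one_mul_choose_eq n m
  have h3 : ((n + 1).choose (m + 1) : ℝ) ≠ 0 := by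
    exact_mod_cast (Nat.choose_pos hm).ne'
  have h4 : ((n : ℝ) + 1) * n.choose m = (n + 1).choose (m + 1) * (m + 1) := by
    exact_mod_cast h2
  simp only [Nat.add_sub_cancel]
  push_cast
  rw [div_eq_div_iff h3 (by positivity)]
  linarith

theorem avI_mem2 {n m : ℕ} (hm1 : 1 ≤ m) (hm : m ≤ n) (hn : 2 ≤ n) (i j : Fin n) (hij : i ≠ j) :
    avI m (fun I => if i ∈ I ∧ j ∈ I then (1 : ℝ) else 0) = (m : ℝ) * (m - 1) / (n * (n - 1)) := by
  unfold avI
  rw [Finset.sum_boole]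
  rcases Nat.lt_or_ge m 2 with h1 | h1
  · obtain rfl : m = 1 := by omega
    have : Finset.filter (fun I => i ∈ I ∧ j ∈ I) (Finset.powersetCard 1 (Finset.univ : Finset (Fin n))) = ∅ := by
      apply Finset.filter_eq_empty_iff.2
      rintro I hI ⟨h1, h2⟩
      have hc : I.card = 1 := by simpa using hI
      exact hij (Finset.card_le_one.1 hc.le _ h1 _ h2)
    rw [this]; simp
  have h := Finset.card_filter_powersetCard_subset {i, j} (Finset.univ : Finset (Fin n)) m
    (by simp) (by rw [Finset.card_pair hij]; exact h1)
  simp only [Finset.card_pair hij, Finset.insert_subset_iff, Finset.singleton_subset_iff, Finset.card_univ, Fintype.card_fin] at h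
  rw [h]
  obtain ⟨n, rfl⟩ : ∃ k, n = k + 2 := ⟨n - 2, by omega⟩
  obtain ⟨m, rfl⟩ : ∃ k, m = k + 2 := ⟨m - 2, by omega⟩
  have h2 := Nat.add_one_mul_choose_eq n m
  have h2' := Nat.add_one_mul_choose_eq (n + 1) (m + 1)
  have h3 : ((n + 2).choose (m + 2) : ℝ) ≠ 0 := by
    exact_mod_cast (Nat.choose_pos hm).ne'
  have h4 : ((n : ℝ) + 1) * n.choose m = (n + 1).choose (m + 1) * (m + 1) := by
    exact_mod_cast h2
  have h5 : ((n : ℝ) + 1 + 1) * (n + 1).choose (m + 1) = (n + 2).choose (m + 2) * (m + 1 + 1) := by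
    exact_mod_cast h2'
  simp only [Nat.add_sub_cancel]
  push_cast
  have h6 : ((n : ℝ) + 2) * (n + 2 - 1) ≠ 0 := by
    have : (n : ℝ) + 2 - 1 = n + 1 := by ring
    rw [this]; positivity
  rw [div_eq_div_iff h3 h6]
  linear_combination ((n : ℝ) + 2) * h4 + (m + 1) * h5

/-- Sampling without replacement, second moment. -/
theorem avI_var {n m : ℕ} {E : Type*} [NormedAddCommGroup E] [InnerProductSpace ℝ E]
    (hm1 : 1 ≤ m) (hm : m ≤ n) (hn : 2 ≤ n) (w : E) (z : Fin n → E) :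
    avI m (fun I => ‖w + ((m : ℝ)⁻¹ • ∑ i ∈ I, z i - (n : ℝ)⁻¹ • ∑ i, z i)‖ ^ 2)
      ≤ ‖w‖ ^ 2 + ((n : ℝ) - m) / ((n - 1) * m) * ((n : ℝ)⁻¹ * ∑ i, ‖z i‖ ^ 2) := by
  have hn0 : (0 : ℝ) < n := by exact_mod_cast (by omega : 0 < n)
  have hn1 : (0 : ℝ) < (n : ℝ) - 1 := by
    have : (2 : ℝ) ≤ n := by exact_mod_cast hn
    linarith
  have hm0 : (0 : ℝ) < m := by exact_mod_cast hm1
  set zb : E := (n : ℝ)⁻¹ • ∑ i, z i with hzb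
  set c : Fin n → E := fun i => z i - zb with hc
  have hsumz : ∑ i, z i = (n : ℝ) • zb := by
    rw [hzb, smul_smul, mul_inv_cancel₀ hn0.ne', one_smul]
  have hsumc : ∑ i, c i = 0 := by
    simp only [hc, Finset.sum_sub_distrib, Finset.sum_const, Finset.card_univ, Fintype.card_fin]
    rw [hsumz, Nat.cast_smul_eq_nsmul, sub_self]
  have hcz : ∑ i, ‖c i‖ ^ 2 ≤ ∑ i, ‖z i‖ ^ 2 := by
    have : ∑ i, ‖c i‖ ^ 2 = ∑ i, ‖z i‖ ^ 2 - n * ‖zb‖ ^ 2 := by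
      simp only [hc, norm_sub_sq_real, Finset.sum_add_distrib, Finset.sum_sub_distrib,
        Finset.sum_const, Finset.card_univ, Fintype.card_fin, ← Finset.mul_sum, ← sum_inner,
        nsmul_eq_mul]
      rw [hsumz, real_inner_smul_left, real_inner_self_eq_norm_sq]
      ring
    rw [this]
    have : 0 ≤ n * ‖zb‖ ^ 2 := by positivity
    linarith
  have hpt : ∀ I : Finset (Fin n), I.card = m →
      ‖w + ((m : ℝ)⁻¹ • ∑ i ∈ I, z i - zb)‖ ^ 2
        = ‖w‖ ^ 2 + ((∑ i, (2 * (m : ℝ)⁻¹ * inner ℝ w (c i)) * (if i ∈ I then (1 : ℝ) else 0))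
          + ∑ i, ∑ j, ((m : ℝ)⁻¹ ^ 2 * inner ℝ (c i) (c j)) *
              (if i ∈ I ∧ j ∈ I then (1 : ℝ) else 0)) := by
    intro I hI
    have h1 : (m : ℝ)⁻¹ • ∑ i ∈ I, z i - zb = (m : ℝ)⁻¹ • ∑ i ∈ I, c i := by
      simp only [hc, Finset.sum_sub_distrib, Finset.sum_const, hI]
      rw [smul_sub, ← Nat.cast_smul_eq_nsmul ℝ, smul_smul, inv_mul_cancel₀ hm0.ne', one_smul]
    have h2 : ∑ i, (2 * (m : ℝ)⁻¹ * inner ℝ w (c i)) * (if i ∈ I then (1 : ℝ) else 0)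
        = 2 * (m : ℝ)⁻¹ * inner ℝ w (∑ i ∈ I, c i) := by
      rw [inner_sum, Finset.mul_sum]
      simp [Finset.sum_ite_mem]
    have h3 : ∑ i, ∑ j, ((m : ℝ)⁻¹ ^ 2 * inner ℝ (c i) (c j)) *
              (if i ∈ I ∧ j ∈ I then (1 : ℝ) else 0)
        = (m : ℝ)⁻¹ ^ 2 * ‖∑ i ∈ I, c i‖ ^ 2 := by
      rw [← real_inner_self_eq_norm_sq, sum_inner, Finset.mul_sum,
        ← Finset.sum_filter_add_sum_filter_not Finset.univ (fun i => i ∈ I)]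
      rw [Finset.sum_eq_zero (s := Finset.filter (fun i => ¬ i ∈ I) Finset.univ), add_zero]
      · rw [Finset.filter_univ_mem]
        apply Finset.sum_congr rfl
        intro i hi
        rw [inner_sum, Finset.mul_sum]
        simp [hi, Finset.sum_ite_mem]
      · intro i hi
        have : i ∉ I := by simpa using hi
        simp [this]
    rw [h1, h2, h3, norm_add_sq_real, real_inner_smul_right, norm_smul, mul_pow]
    simp only [norm_inv, RCLike.norm_natCast]
    ring
  have hq : ∀ i j : Fin n, avI m (fun I => if i ∈ I ∧ j ∈ I then (1 : ℝ) else 0)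
      = (m : ℝ) * (m - 1) / (n * (n - 1)) +
        (if i = j then (m : ℝ) / n - (m : ℝ) * (m - 1) / (n * (n - 1)) else 0) := by
    intro i j
    by_cases hij : i = j
    · subst hij
      simp only [and_self, if_true]
      rw [avI_mem hm1 hm]; ring
    · rw [avI_mem2 hm1 hm hn i j hij, if_neg hij, add_zero]
  calc _ ≤ avI m (fun I => ‖w‖ ^ 2 + ((∑ i, (2 * (m : ℝ)⁻¹ * inner ℝ w (c i)) * (if i ∈ I then (1 : ℝ) else 0))
          + ∑ i, ∑ j, ((m : ℝ)⁻¹ ^ 2 * inner ℝ (c i) (c j)) *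
              (if i ∈ I ∧ j ∈ I then (1 : ℝ) else 0))) := avI_mono fun I hI => (hpt I hI).le
    _ = ‖w‖ ^ 2 + (∑ i, (2 * (m : ℝ)⁻¹ * inner ℝ w (c i)) * ((m : ℝ) / n)
          + ∑ i, ∑ j, ((m : ℝ)⁻¹ ^ 2 * inner ℝ (c i) (c j)) *
            ((m : ℝ) * (m - 1) / (n * (n - 1)) +
        (if i = j then (m : ℝ) / n - (m : ℝ) * (m - 1) / (n * (n - 1)) else 0))) := by
      rw [avI_add, avI_const hm, avI_add, avI_sum, avI_sum]
      simp only [avI_sum, avI_smul, hq, avI_mem hm1 hm]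
    _ = ‖w‖ ^ 2 + ((n : ℝ) - m) / ((n - 1) * m) * ((n : ℝ)⁻¹ * ∑ i, ‖c i‖ ^ 2) := by
      have e1 : ∑ i, (2 * (m : ℝ)⁻¹ * inner ℝ w (c i)) * ((m : ℝ) / n) = 0 := by
        rw [← Finset.sum_mul, ← Finset.mul_sum, ← inner_sum, hsumc]; simp
      have e2 : ∀ i, ∑ j, ((m : ℝ)⁻¹ ^ 2 * inner ℝ (c i) (c j)) *
            ((m : ℝ) * (m - 1) / (n * (n - 1)) +
            (if i = j then (m : ℝ) / n - (m : ℝ) * (m - 1) / (n * (n - 1)) else 0))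
          = (m : ℝ)⁻¹ ^ 2 * ((m : ℝ) / n - (m : ℝ) * (m - 1) / (n * (n - 1))) * ‖c i‖ ^ 2 := by
        intro i
        simp only [mul_add, Finset.sum_add_distrib, ← Finset.sum_mul, ← Finset.mul_sum, ← inner_sum,
          hsumc, inner_zero_right, mul_ite, mul_zero, zero_mul, Finset.sum_ite_eq, Finset.mem_univ, if_true,
          real_inner_self_eq_norm_sq, zero_add]
        ring
      rw [e1, Finset.sum_congr rfl (fun i _ => e2 i), ← Finset.mul_sum]
      field_simp
      ring
    _ ≤ _ := by
      have : (m : ℝ) ≤ n := by exact_mod_cast hm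
      have : 0 ≤ (n : ℝ) - m := by linarith
      gcongr

/-- One step of the process, as a map on states. -/
def zsStep {d n : ℕ} (f : Fin n → EuclideanSpace ℝ (Fin d) → ℝ) (η lam : ℝ) (b : ℕ)
    (st : EuclideanSpace ℝ (Fin d) × EuclideanSpace ℝ (Fin d) ×
      EuclideanSpace ℝ (Fin d) × (Fin n → EuclideanSpace ℝ (Fin d))) (I : Finset (Fin n)) :
    EuclideanSpace ℝ (Fin d) × EuclideanSpace ℝ (Fin d) ×
      EuclideanSpace ℝ (Fin d) × (Fin n → EuclideanSpace ℝ (Fin d)) :=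
      let v : EuclideanSpace ℝ (Fin d) :=
        (b : ℝ)⁻¹ • ∑ i ∈ I, (gradient (f i) st.1 - gradient (f i) st.2.1)
          + (1 - lam) • st.2.2.1
          + lam • ((b : ℝ)⁻¹ • ∑ i ∈ I, (gradient (f i) st.2.1 - st.2.2.2 i)
              + (n : ℝ)⁻¹ • ∑ j, st.2.2.2 j)
      (st.1 - η • v, st.1, v,
        fun i => if i ∈ I then gradient (f i) st.1 else st.2.2.2 i)

theorem zsState_succ {d n : ℕ} (f : Fin n → EuclideanSpace ℝ (Fin d) → ℝ)
    (η lam : ℕ → ℝ) (b : ℕ → ℕ) (x0 : EuclideanSpace ℝ (Fin d))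
    (ω : ℕ → Finset (Fin n)) (k : ℕ) :
    zsState f η lam b x0 ω (k + 1)
      = zsStep f (η k) (lam k) (b k) (zsState f η lam b x0 ω k) (ω k) := rfl

theorem zsState_congr {d n : ℕ} (f : Fin n → EuclideanSpace ℝ (Fin d) → ℝ)
    (η lam : ℕ → ℝ) (b : ℕ → ℕ) (x0 : EuclideanSpace ℝ (Fin d))
    (ω ω' : ℕ → Finset (Fin n)) (k : ℕ) (h : ∀ j < k, ω j = ω' j) :
    zsState f η lam b x0 ω k = zsState f η lam b x0 ω' k := by
  induction k with
  | zero => rfl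
  | succ k ih =>
    rw [zsState_succ, zsState_succ, ih (fun j hj => h j (by omega)), h k (by omega)]

theorem sum_snoc {n : ℕ} (b : ℕ → ℕ) (k : ℕ) (φ : (Fin (k + 1) → Finset (Fin n)) → ℝ) :
    ∑ τ ∈ Finset.univ.filter
      (fun τ : Fin (k + 1) → Finset (Fin n) => ∀ j : Fin (k + 1), (τ j).card = b j.val), φ τ
    = ∑ τ ∈ Finset.univ.filter
      (fun τ : Fin k → Finset (Fin n) => ∀ j : Fin k, (τ j).card = b j.val),
        ∑ I ∈ Finset.powersetCard (b k) Finset.univ,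
          φ (Fin.snoc (α := fun _ => Finset (Fin n)) τ I) := by
  rw [Finset.sum_filter, ← (Fin.snocEquiv (fun _ : Fin (k + 1) => Finset (Fin n))).sum_comp,
    Fintype.sum_prod_type, Finset.sum_comm, Finset.sum_filter]
  apply Finset.sum_congr rfl
  intro τ _
  rw [Finset.powersetCard_eq_filter, Finset.powerset_univ, Finset.sum_filter]
  simp only [Fin.snocEquiv_apply, Fin.forall_fin_succ', Fin.snoc_castSucc, Fin.snoc_last,
    Fin.val_castSucc, Fin.val_last]
  by_cases h : ∀ j : Fin k, (τ j).card = b j.val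
  · simp [h]
    rfl
  · simp [h]

/-- Expectation of a functional of the `k`-th state. -/
def Mop {d n : ℕ} (f : Fin n → EuclideanSpace ℝ (Fin d) → ℝ)
    (η lam : ℕ → ℝ) (b : ℕ → ℕ) (x0 : EuclideanSpace ℝ (Fin d)) (k : ℕ)
    (h : EuclideanSpace ℝ (Fin d) × EuclideanSpace ℝ (Fin d) ×
      EuclideanSpace ℝ (Fin d) × (Fin n → EuclideanSpace ℝ (Fin d)) → ℝ) : ℝ :=
  zsExpK b k (fun ω => h (zsState f η lam b x0 ω k))

section
variable {d n : ℕ} (f : Fin n → EuclideanSpace ℝ (Fin d) → ℝ)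
    (η lam : ℕ → ℝ) (b : ℕ → ℕ) (x0 : EuclideanSpace ℝ (Fin d)) (k : ℕ)

theorem Mop_mono {h h' : EuclideanSpace ℝ (Fin d) × EuclideanSpace ℝ (Fin d) ×
      EuclideanSpace ℝ (Fin d) × (Fin n → EuclideanSpace ℝ (Fin d)) → ℝ}
    (hh : ∀ st, h st ≤ h' st) : Mop f η lam b x0 k h ≤ Mop f η lam b x0 k h' := by
  unfold Mop zsExpK
  apply div_le_div_of_nonneg_right _ (by positivity)
  exact Finset.sum_le_sum fun _ _ => hh _

theorem Mop_add (h h' : EuclideanSpace ℝ (Fin d) × EuclideanSpace ℝ (Fin d) ×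
      EuclideanSpace ℝ (Fin d) × (Fin n → EuclideanSpace ℝ (Fin d)) → ℝ) :
    Mop f η lam b x0 k (fun st => h st + h' st)
      = Mop f η lam b x0 k h + Mop f η lam b x0 k h' := by
  unfold Mop zsExpK
  rw [Finset.sum_add_distrib, add_div]

theorem Mop_smul (c : ℝ) (h : EuclideanSpace ℝ (Fin d) × EuclideanSpace ℝ (Fin d) ×
      EuclideanSpace ℝ (Fin d) × (Fin n → EuclideanSpace ℝ (Fin d)) → ℝ) :
    Mop f η lam b x0 k (fun st => c * h st) = c * Mop f η lam b x0 k h := by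
  unfold Mop zsExpK
  rw [← Finset.mul_sum, mul_div_assoc]

theorem Mop_zero (h : EuclideanSpace ℝ (Fin d) × EuclideanSpace ℝ (Fin d) ×
      EuclideanSpace ℝ (Fin d) × (Fin n → EuclideanSpace ℝ (Fin d)) → ℝ) :
    Mop f η lam b x0 0 h = h (x0, x0, 0, fun _ => 0) := by
  simp [Mop, zsExpK, zsState]

theorem Mop_succ (h : EuclideanSpace ℝ (Fin d) × EuclideanSpace ℝ (Fin d) ×
      EuclideanSpace ℝ (Fin d) × (Fin n → EuclideanSpace ℝ (Fin d)) → ℝ) :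
    Mop f η lam b x0 (k + 1) h
      = Mop f η lam b x0 k
          (fun st => avI (b k) (fun I => h (zsStep f (η k) (lam k) (b k) st I))) := by
  have hcard := sum_snoc (n := n) b k (fun _ => 1)
  simp only [Finset.sum_const, nsmul_eq_mul, mul_one, Finset.card_powersetCard,
    Finset.card_univ, Fintype.card_fin] at hcard
  unfold Mop zsExpK
  rw [hcard, sum_snoc, ← div_div, div_right_comm, Finset.sum_div]
  congr 1
  apply Finset.sum_congr rfl
  intro τ _
  unfold avI
  congr 1
  apply Finset.sum_congr rfl
  intro I _
  beta_reduce
  rw [zsState_succ]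
  congr 1
  congr 1
  · apply zsState_congr
    intro j hj
    have : j < k + 1 := by omega
    simp only [this, hj, dif_pos]
    exact Fin.snoc_castSucc (α := fun _ => Finset (Fin n)) I τ ⟨j, hj⟩
  · simp only [Nat.lt_succ_self, dif_pos]
    exact Fin.snoc_last (α := fun _ => Finset (Fin n)) I τ

theorem Mop_const (hb : ∀ k, b k ≤ n) (c : ℝ) :
    Mop f η lam b x0 k (fun _ => c) = c := by
  induction k with
  | zero => rw [Mop_zero]
  | succ k ih =>
    rw [Mop_succ]
    simp only [avI_const (hb k)]
    exact ih

end

theorem young_sq {E : Type*} [NormedAddCommGroup E] [InnerProductSpace ℝ E] (p q : E) (β : ℝ)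
    (hβ : 0 < β) : ‖p + q‖ ^ 2 ≤ (1 + β) * ‖p‖ ^ 2 + (1 + β⁻¹) * ‖q‖ ^ 2 := by
  have h1 : ‖p + q‖ ^ 2 ≤ (‖p‖ + ‖q‖) ^ 2 := by
    gcongr
    exact norm_add_le p q
  have h2 : 0 ≤ β⁻¹ * (β * ‖p‖ - ‖q‖) ^ 2 := by positivity
  have h3 : β⁻¹ * (β * ‖p‖ - ‖q‖) ^ 2 = β * ‖p‖ ^ 2 - 2 * ‖p‖ * ‖q‖ + β⁻¹ * ‖q‖ ^ 2 := by
    field_simp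
    ring
  nlinarith

theorem hasGradientAt_avgF {d n : ℕ} (f : Fin n → EuclideanSpace ℝ (Fin d) → ℝ)
    (hdiff : ∀ i, Differentiable ℝ (f i)) (x : EuclideanSpace ℝ (Fin d)) :
    HasGradientAt (avgF f) ((n : ℝ)⁻¹ • ∑ i, gradient (f i) x) x := by
  rw [hasGradientAt_iff_hasFDerivAt]
  have h : ∀ i ∈ (Finset.univ : Finset (Fin n)), HasFDerivAt (f i)
      (InnerProductSpace.toDual ℝ _ (gradient (f i) x)) x := fun i _ =>
    hasGradientAt_iff_hasFDerivAt.1 (hdiff i x).hasGradientAt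
  have := (HasFDerivAt.fun_sum h).const_mul ((n : ℝ)⁻¹)
  simp only [map_smul, map_sum]
  exact this

theorem gradient_avgF {d n : ℕ} (f : Fin n → EuclideanSpace ℝ (Fin d) → ℝ)
    (hdiff : ∀ i, Differentiable ℝ (f i)) (x : EuclideanSpace ℝ (Fin d)) :
    gradient (avgF f) x = (n : ℝ)⁻¹ • ∑ i, gradient (f i) x :=
  (hasGradientAt_avgF f hdiff x).gradient

theorem smooth_avgF {d n : ℕ} (hn : 2 ≤ n) (L : ℝ)
    (f : Fin n → EuclideanSpace ℝ (Fin d) → ℝ)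
    (hdiff : ∀ i, Differentiable ℝ (f i))
    (hsmooth : ∀ i (x y : EuclideanSpace ℝ (Fin d)),
      ‖gradient (f i) x - gradient (f i) y‖ ≤ L * ‖x - y‖) (x y : EuclideanSpace ℝ (Fin d)) :
    ‖gradient (avgF f) x - gradient (avgF f) y‖ ≤ L * ‖x - y‖ := by
  have hn0 : (0 : ℝ) < n := by exact_mod_cast (by omega : 0 < n)
  rw [gradient_avgF f hdiff, gradient_avgF f hdiff, ← smul_sub, ← Finset.sum_sub_distrib, norm_smul]
  calc _ ≤ ‖(n : ℝ)⁻¹‖ * ∑ i : Fin n, L * ‖x - y‖ := by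
        gcongr
        exact (norm_sum_le _ _).trans (Finset.sum_le_sum fun i _ => hsmooth i x y)
    _ = L * ‖x - y‖ := by
        simp
        field_simp

/-- The descent lemma for smooth functions. -/
theorem descent_lemma {E : Type*} [NormedAddCommGroup E] [InnerProductSpace ℝ E] [CompleteSpace E]
    (g : E → ℝ) (g' : E → E) (L : ℝ) (hg : ∀ x, HasGradientAt g (g' x) x)
    (hs : ∀ x y, ‖g' x - g' y‖ ≤ L * ‖x - y‖) (x u : E) :
    g (x + u) ≤ g x + inner ℝ (g' x) u + L / 2 * ‖u‖ ^ 2 := by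
  set φ : ℝ → ℝ := fun t => g (x + t • u) - t * inner ℝ (g' x) u - L / 2 * t ^ 2 * ‖u‖ ^ 2 with hφ
  have hd : ∀ t, HasDerivAt φ
      (inner ℝ (g' (x + t • u)) u - inner ℝ (g' x) u - L * t * ‖u‖ ^ 2) t := by
    intro t
    have h1 : HasDerivAt (fun t : ℝ => x + t • u) u t := by
      simpa using ((hasDerivAt_id t).smul_const u).const_add x
    have h2 := (hasGradientAt_iff_hasFDerivAt.1 (hg (x + t • u))).comp_hasDerivAt t h1
    have h3 : HasDerivAt (fun t : ℝ => t * inner ℝ (g' x) u) (inner ℝ (g' x) u) t := by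
      simpa using (hasDerivAt_id t).mul_const (inner ℝ (g' x) u)
    have h4 : HasDerivAt (fun t : ℝ => L / 2 * t ^ 2 * ‖u‖ ^ 2) (L * t * ‖u‖ ^ 2) t := by
      have := ((hasDerivAt_pow 2 t).const_mul (L / 2)).mul_const (‖u‖ ^ 2)
      refine this.congr_deriv ?_
      rw [show (2 - 1 : ℕ) = 1 from rfl]
      push_cast
      ring
    have := (h2.sub h3).sub h4
    simp only [InnerProductSpace.toDual_apply_apply] at this
    exact this
  have hanti : AntitoneOn φ (Set.Icc 0 1) := by
    apply antitoneOn_of_deriv_nonpos (convex_Icc 0 1)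
    · exact fun t _ => (hd t).continuousAt.continuousWithinAt
    · exact fun t _ => (hd t).differentiableAt.differentiableWithinAt
    · intro t ht
      rw [interior_Icc] at ht
      rw [(hd t).deriv, ← inner_sub_left]
      have h1 := real_inner_le_norm (g' (x + t • u) - g' x) u
      have h2 := hs (x + t • u) x
      rw [add_sub_cancel_left, norm_smul, Real.norm_of_nonneg ht.1.le] at h2
      nlinarith [norm_nonneg u]
  have h01 := hanti (Set.left_mem_Icc.2 zero_le_one) (Set.right_mem_Icc.2 zero_le_one) zero_le_one
  simp only [hφ, one_smul, zero_smul, add_zero] at h01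
  linarith

theorem V_step {d n : ℕ} (hn : 2 ≤ n) (f : Fin n → EuclideanSpace ℝ (Fin d) → ℝ)
    (hdiff : ∀ i, Differentiable ℝ (f i)) (η lam : ℝ) (b : ℕ) (hb1 : 1 ≤ b) (hb : b ≤ n)
    (st : EuclideanSpace ℝ (Fin d) × EuclideanSpace ℝ (Fin d) ×
      EuclideanSpace ℝ (Fin d) × (Fin n → EuclideanSpace ℝ (Fin d))) :
    avI b (fun I => ‖(zsStep f η lam b st I).2.2.1
        - gradient (avgF f) (zsStep f η lam b st I).2.1‖ ^ 2)
      ≤ (1 - lam) ^ 2 * ‖st.2.2.1 - gradient (avgF f) st.2.1‖ ^ 2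
        + ((n : ℝ) - b) / ((n - 1) * b) * ((n : ℝ)⁻¹ * ∑ i,
          ‖(gradient (f i) st.1 - gradient (f i) st.2.1)
            + lam • (gradient (f i) st.2.1 - st.2.2.2 i)‖ ^ 2) := by
  have h := avI_var hb1 hb hn ((1 - lam) • (st.2.2.1 - gradient (avgF f) st.2.1))
    (fun i => (gradient (f i) st.1 - gradient (f i) st.2.1)
            + lam • (gradient (f i) st.2.1 - st.2.2.2 i))
  rw [norm_smul, mul_pow, Real.norm_eq_abs, sq_abs] at h
  refine le_trans (le_of_eq ?_) h
  congr 1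
  funext I
  congr 2
  simp only [zsStep, gradient_avgF f hdiff, Finset.sum_add_distrib, Finset.sum_sub_distrib,
    ← Finset.smul_sum]
  module

theorem Y_step {d n : ℕ} (f : Fin n → EuclideanSpace ℝ (Fin d) → ℝ)
    (η lam : ℝ) (b : ℕ) (hb1 : 1 ≤ b) (hb : b ≤ n)
    (st : EuclideanSpace ℝ (Fin d) × EuclideanSpace ℝ (Fin d) ×
      EuclideanSpace ℝ (Fin d) × (Fin n → EuclideanSpace ℝ (Fin d))) :
    avI b (fun I => (n : ℝ)⁻¹ * ∑ i, ‖gradient (f i) (zsStep f η lam b st I).2.1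
        - (zsStep f η lam b st I).2.2.2 i‖ ^ 2)
      = (1 - (b : ℝ) / n) * ((n : ℝ)⁻¹ * ∑ i, ‖gradient (f i) st.1 - st.2.2.2 i‖ ^ 2) := by
  have h : ∀ I : Finset (Fin n), ∀ i, ‖gradient (f i) (zsStep f η lam b st I).2.1
        - (zsStep f η lam b st I).2.2.2 i‖ ^ 2 =
        ‖gradient (f i) st.1 - st.2.2.2 i‖ ^ 2 + (- ‖gradient (f i) st.1 - st.2.2.2 i‖ ^ 2) *
          (if i ∈ I then 1 else 0) := by
    intro I i
    by_cases hi : i ∈ I <;> simp [zsStep, hi]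
  simp only [h]
  rw [avI_smul, avI_sum]
  simp only [avI_add, avI_const hb, avI_smul, avI_mem hb1 hb]
  simp only [Finset.mul_sum]
  apply Finset.sum_congr rfl
  intro i _
  ring

theorem V_step' {d n r : ℕ} (hr2 : 2 ≤ r) (hr : n = r ^ 2) (L : ℝ)
    (f : Fin n → EuclideanSpace ℝ (Fin d) → ℝ)
    (hdiff : ∀ i, Differentiable ℝ (f i))
    (hsmooth : ∀ i (x y : EuclideanSpace ℝ (Fin d)),
      ‖gradient (f i) x - gradient (f i) y‖ ≤ L * ‖x - y‖) (η : ℝ)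
    (st : EuclideanSpace ℝ (Fin d) × EuclideanSpace ℝ (Fin d) ×
      EuclideanSpace ℝ (Fin d) × (Fin n → EuclideanSpace ℝ (Fin d))) :
    avI r (fun I => ‖(zsStep f η (1 / (2 * (r : ℝ))) r st I).2.2.1
        - gradient (avgF f) (zsStep f η (1 / (2 * (r : ℝ))) r st I).2.1‖ ^ 2)
      ≤ (1 - 1 / (2 * (r : ℝ))) ^ 2 * ‖st.2.2.1 - gradient (avgF f) st.2.1‖ ^ 2
        + (3 / (8 * (r : ℝ) ^ 3) * ((n : ℝ)⁻¹ * ∑ i, ‖gradient (f i) st.2.1 - st.2.2.2 i‖ ^ 2)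
        + 3 * L ^ 2 / r * ‖st.1 - st.2.1‖ ^ 2) := by
  have hn : 2 ≤ n := by rw [hr]; nlinarith
  have hrn : r ≤ n := by rw [hr]; nlinarith
  have hr0 : (0 : ℝ) < r := by exact_mod_cast (by omega : 0 < r)
  have hn0 : (0 : ℝ) < n := by exact_mod_cast (by omega : 0 < n)
  have hn1 : (0 : ℝ) < (n : ℝ) - 1 := by
    have : (2 : ℝ) ≤ n := by exact_mod_cast hn
    linarith
  have hr1 : (1 : ℝ) ≤ r := by exact_mod_cast (by omega : 1 ≤ r)
  refine (V_step hn f hdiff η _ r (by omega) hrn st).trans ?_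
  gcongr
  have h1 : ∀ i, ‖(gradient (f i) st.1 - gradient (f i) st.2.1)
            + (1 / (2 * (r : ℝ))) • (gradient (f i) st.2.1 - st.2.2.2 i)‖ ^ 2
      ≤ 3 * L ^ 2 * ‖st.1 - st.2.1‖ ^ 2
        + 3 / (8 * (r : ℝ) ^ 2) * ‖gradient (f i) st.2.1 - st.2.2.2 i‖ ^ 2 := by
    intro i
    refine (young_sq _ _ 2 (by norm_num)).trans ?_
    rw [norm_smul, mul_pow, Real.norm_eq_abs, sq_abs]
    have : ‖gradient (f i) st.1 - gradient (f i) st.2.1‖ ^ 2 ≤ (L * ‖st.1 - st.2.1‖) ^ 2 := by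
      gcongr
      exact hsmooth i _ _
    rw [mul_pow] at this
    have e : (1 + (2 : ℝ)⁻¹) * ((1 / (2 * (r : ℝ))) ^ 2 * ‖gradient (f i) st.2.1 - st.2.2.2 i‖ ^ 2)
      = 3 / (8 * (r : ℝ) ^ 2) * ‖gradient (f i) st.2.1 - st.2.2.2 i‖ ^ 2 := by
      field_simp; norm_num; ring
    rw [e]
    linarith
  have h2 : ((n : ℝ) - r) / ((n - 1) * r) ≤ 1 / r := by
    rw [div_le_div_iff₀ (by positivity) hr0]
    nlinarith
  have h2' : 0 ≤ ((n : ℝ) - r) / ((n - 1) * r) := by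
    have : (r : ℝ) ≤ n := by exact_mod_cast hrn
    have : 0 ≤ (n : ℝ) - r := by linarith
    positivity
  calc _ ≤ 1 / (r : ℝ) * ((n : ℝ)⁻¹ * ∑ i, (3 * L ^ 2 * ‖st.1 - st.2.1‖ ^ 2
        + 3 / (8 * (r : ℝ) ^ 2) * ‖gradient (f i) st.2.1 - st.2.2.2 i‖ ^ 2)) := by
        gcongr with i
        exact h1 i
    _ = _ := by
      simp only [Finset.sum_add_distrib, Finset.sum_const, Finset.card_univ, Fintype.card_fin,
        nsmul_eq_mul, ← Finset.mul_sum]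
      field_simp
      ring

theorem Y_step' {d n r : ℕ} (hr2 : 2 ≤ r) (hr : n = r ^ 2) (L : ℝ)
    (f : Fin n → EuclideanSpace ℝ (Fin d) → ℝ)
    (hsmooth : ∀ i (x y : EuclideanSpace ℝ (Fin d)),
      ‖gradient (f i) x - gradient (f i) y‖ ≤ L * ‖x - y‖) (η lam : ℝ)
    (st : EuclideanSpace ℝ (Fin d) × EuclideanSpace ℝ (Fin d) ×
      EuclideanSpace ℝ (Fin d) × (Fin n → EuclideanSpace ℝ (Fin d))) :
    avI r (fun I => (n : ℝ)⁻¹ * ∑ i, ‖gradient (f i) (zsStep f η lam r st I).2.1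
        - (zsStep f η lam r st I).2.2.2 i‖ ^ 2)
      ≤ (1 - 3 / (4 * (r : ℝ)))
          * ((n : ℝ)⁻¹ * ∑ i, ‖gradient (f i) st.2.1 - st.2.2.2 i‖ ^ 2)
        + 4 * r * L ^ 2 * ‖st.1 - st.2.1‖ ^ 2 := by
  have hrn : r ≤ n := by rw [hr]; nlinarith
  have hr0 : (0 : ℝ) < r := by exact_mod_cast (by omega : 0 < r)
  have hn0 : (0 : ℝ) < n := by rw [hr]; positivity
  have hr1 : (2 : ℝ) ≤ r := by exact_mod_cast hr2
  rw [Y_step f η lam r (by omega) hrn]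
  have h0 : 1 - (r : ℝ) / n = 1 - 1 / r := by
    rw [hr]; push_cast; field_simp
  have h0' : 0 ≤ 1 - 1 / (r : ℝ) := by
    rw [sub_nonneg, div_le_one hr0]; linarith
  rw [h0]
  have h1 : ∀ i, ‖gradient (f i) st.1 - st.2.2.2 i‖ ^ 2
      ≤ (1 + 1 / (4 * (r : ℝ))) * ‖gradient (f i) st.2.1 - st.2.2.2 i‖ ^ 2
        + (1 + 4 * r) * L ^ 2 * ‖st.1 - st.2.1‖ ^ 2 := by
    intro i
    have e : gradient (f i) st.1 - st.2.2.2 i = (gradient (f i) st.2.1 - st.2.2.2 i)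
      + (gradient (f i) st.1 - gradient (f i) st.2.1) := by abel
    rw [e]
    refine (young_sq _ _ (1 / (4 * (r : ℝ))) (by positivity)).trans ?_
    rw [one_div, inv_inv]
    have : ‖gradient (f i) st.1 - gradient (f i) st.2.1‖ ^ 2 ≤ (L * ‖st.1 - st.2.1‖) ^ 2 := by
      gcongr
      exact hsmooth i _ _
    rw [mul_pow] at this
    rw [mul_assoc (1 + 4 * (r : ℝ))]
    gcongr
  set Y := (n : ℝ)⁻¹ * ∑ i, ‖gradient (f i) st.2.1 - st.2.2.2 i‖ ^ 2 with hY
  have hY0 : 0 ≤ Y := by positivity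
  calc _ ≤ (1 - 1 / (r : ℝ)) * ((n : ℝ)⁻¹ * ∑ i, ((1 + 1 / (4 * (r : ℝ))) *
          ‖gradient (f i) st.2.1 - st.2.2.2 i‖ ^ 2
        + (1 + 4 * r) * L ^ 2 * ‖st.1 - st.2.1‖ ^ 2)) := by
        gcongr with i
        exact h1 i
    _ = (1 - 1 / (r : ℝ)) * (1 + 1 / (4 * (r : ℝ))) * Y
        + (1 - 1 / (r : ℝ)) * (1 + 4 * r) * (L ^ 2 * ‖st.1 - st.2.1‖ ^ 2) := by
      rw [Finset.sum_add_distrib, ← Finset.mul_sum, hY]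
      simp only [Finset.sum_const, Finset.card_univ, Fintype.card_fin, nsmul_eq_mul]
      field_simp
    _ ≤ (1 - 3 / (4 * (r : ℝ))) * Y + 4 * r * (L ^ 2 * ‖st.1 - st.2.1‖ ^ 2) := by
      have a1 : (1 - 1 / (r : ℝ)) * (1 + 1 / (4 * (r : ℝ))) ≤ 1 - 3 / (4 * (r : ℝ)) := by
        have : (1 - 1 / (r : ℝ)) * (1 + 1 / (4 * (r : ℝ)))
          = 1 - 3 / (4 * (r : ℝ)) - 1 / (4 * (r : ℝ) ^ 2) := by field_simp; ring
        rw [this]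
        have : 0 ≤ 1 / (4 * (r : ℝ) ^ 2) := by positivity
        linarith
      have a2 : (1 - 1 / (r : ℝ)) * (1 + 4 * r) ≤ 4 * r := by
        have : (1 - 1 / (r : ℝ)) * (1 + 4 * r) = 4 * r - 3 - 1 / r := by field_simp; ring
        rw [this]
        have : 0 ≤ 1 / (r : ℝ) := by positivity
        linarith
      gcongr
    _ = _ := by ring

theorem F_step {d n : ℕ} (hn : 2 ≤ n) (L : ℝ)
    (f : Fin n → EuclideanSpace ℝ (Fin d) → ℝ)
    (hdiff : ∀ i, Differentiable ℝ (f i))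
    (hsmooth : ∀ i (x y : EuclideanSpace ℝ (Fin d)),
      ‖gradient (f i) x - gradient (f i) y‖ ≤ L * ‖x - y‖) (x v : EuclideanSpace ℝ (Fin d)) (η : ℝ) :
    avgF f (x - η • v) + η / 2 * ‖gradient (avgF f) x‖ ^ 2 + η / 2 * (1 - η * L) * ‖v‖ ^ 2
      ≤ avgF f x + η / 2 * ‖v - gradient (avgF f) x‖ ^ 2 := by
  have h := descent_lemma (avgF f) (gradient (avgF f)) L
    (fun x => by rw [gradient_avgF f hdiff]; exact hasGradientAt_avgF f hdiff x)
    (smooth_avgF hn L f hdiff hsmooth) x (-(η • v))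
  rw [← sub_eq_add_neg, norm_neg, norm_smul, inner_neg_right, real_inner_smul_right, mul_pow,
    Real.norm_eq_abs, sq_abs] at h
  rw [norm_sub_sq_real, real_inner_comm]
  linarith

theorem N_lower {E : Type*} [NormedAddCommGroup E] [InnerProductSpace ℝ E] (v g : E) :
    2 / 5 * ‖g‖ ^ 2 ≤ ‖v‖ ^ 2 + 2 / 3 * ‖v - g‖ ^ 2 := by
  have h := young_sq v (g - v) (3 / 2) (by norm_num)
  rw [add_sub_cancel, norm_sub_rev] at h
  norm_num at h
  linarith

theorem seq_main (r : ℝ) (hr : 2 ≤ r) (q η L A' fstar : ℝ) (hη : 0 < η) (hq : q = η * L)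
    (hq1 : 7 * q ^ 2 + 2 * q - 1 = 0) (hq0 : 0 < q)
    (V Y N G F : ℕ → ℝ) (hV0 : ∀ k, 0 ≤ V k) (hY0 : ∀ k, 0 ≤ Y k) (hN0 : ∀ k, 0 ≤ N k)
    (hF0 : ∀ k, fstar ≤ F k) (hA : A' = 2 / η * (F 0 - fstar))
    (hF : ∀ k, F (k + 1) + η / 2 * G k + η / 2 * (1 - η * L) * N k ≤ F k + η / 2 * V k)
    (hV : ∀ k, V (k + 1) ≤ (1 - 1 / (2 * r)) ^ 2 * V k
      + (3 / (8 * r ^ 3) * Y k + 3 * L ^ 2 / r * (η ^ 2 * N k)))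
    (hY : ∀ k, Y (k + 1) ≤ (1 - 3 / (4 * r)) * Y k + 4 * r * L ^ 2 * (η ^ 2 * N k))
    (hN : ∀ k, 2 / 5 * G k ≤ N k + 2 / 3 * V k) (K : ℕ) :
    (∑ k ∈ Finset.range K, G k ≤ A' + 8 * r / 7 * (V 0 + Y 0 / (2 * r ^ 2))) ∧
    (11 / 10 * ∑ k ∈ Finset.range K, G k
      ≤ A' + 7 / 6 * (min (K : ℝ) (8 * r / 7) * (V 0 + Y 0 / (2 * r ^ 2)))) := by
  have hr0 : 0 < r := by linarith
  have hqlo : 1 / 4 ≤ q := by nlinarith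
  set W : ℝ := V 0 + Y 0 / (2 * r ^ 2) with hW
  have hW0 : 0 ≤ W := by
    have := hV0 0
    have := hY0 0
    positivity
  have hstep : ∀ k, V (k + 1) + Y (k + 1) / (2 * r ^ 2) + 7 / (8 * r) * V k
      ≤ V k + Y k / (2 * r ^ 2) + 5 * q ^ 2 / r * N k := by
    intro k
    have h1 := hV k
    have h2 := div_le_div_of_nonneg_right (hY k) (by positivity : 0 ≤ 2 * r ^ 2)
    have h3 : ((1 - 3 / (4 * r)) * Y k + 4 * r * L ^ 2 * (η ^ 2 * N k)) / (2 * r ^ 2)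
      = Y k / (2 * r ^ 2) - 3 / (8 * r ^ 3) * Y k + 2 * q ^ 2 / r * N k := by
      rw [hq]; field_simp; ring
    have h4 : 3 * L ^ 2 / r * (η ^ 2 * N k) = 3 * q ^ 2 / r * N k := by
      rw [hq]; ring
    have h5 : (1 - 1 / (2 * r)) ^ 2 * V k ≤ (1 - 7 / (8 * r)) * V k := by
      apply mul_le_mul_of_nonneg_right _ (hV0 k)
      have : (1 - 1 / (2 * r)) ^ 2 = 1 - 7 / (8 * r) - (r - 2) / (8 * r ^ 2) := by
        field_simp; ring
      rw [this]
      have : 0 ≤ (r - 2) / (8 * r ^ 2) := by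
        apply div_nonneg <;> [linarith; positivity]
      linarith
    have h6 : 5 * q ^ 2 / r * N k = 3 * q ^ 2 / r * N k + 2 * q ^ 2 / r * N k := by ring
    rw [h3] at h2
    rw [h4] at h1
    linarith
  have hcum : ∀ k, V k + Y k / (2 * r ^ 2) + 7 / (8 * r) * ∑ j ∈ Finset.range k, V j
      ≤ W + 5 * q ^ 2 / r * ∑ j ∈ Finset.range k, N j := by
    intro k
    induction k with
    | zero => simp [hW]
    | succ k ih =>
      rw [Finset.sum_range_succ, Finset.sum_range_succ, mul_add, mul_add]
      have := hstep k
      linarith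
  have hSN0 : ∀ k, 0 ≤ ∑ j ∈ Finset.range k, N j := fun k => Finset.sum_nonneg fun j _ => hN0 j
  have hSV0 : ∀ k, 0 ≤ ∑ j ∈ Finset.range k, V j := fun k => Finset.sum_nonneg fun j _ => hV0 j
  set SN := ∑ j ∈ Finset.range K, N j with hSN
  set SV := ∑ j ∈ Finset.range K, V j with hSV
  set SG := ∑ j ∈ Finset.range K, G j with hSG
  have hSNn : 0 ≤ SN := hSN0 K
  set X : ℝ := W + 5 * q ^ 2 / r * SN with hX
  have hX0 : 0 ≤ X := by positivity
  have hb1 : SV ≤ 8 * r / 7 * X := by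
    have h1 := hcum K
    have h2 : 0 ≤ V K := hV0 K
    have h3 : 0 ≤ Y K / (2 * r ^ 2) := div_nonneg (hY0 K) (by positivity)
    have h4 : 7 / (8 * r) * SV ≤ X := by linarith
    calc SV = 8 * r / 7 * (7 / (8 * r) * SV) := by field_simp
      _ ≤ _ := by gcongr
  have hb2 : SV ≤ K * X := by
    have : ∀ k ∈ Finset.range K, V k ≤ X := by
      intro k hk
      have h1 := hcum k
      have h2 : 0 ≤ 7 / (8 * r) * ∑ j ∈ Finset.range k, V j := mul_nonneg (by positivity) (hSV0 k)
      have h3 : 0 ≤ Y k / (2 * r ^ 2) := div_nonneg (hY0 k) (by positivity)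
      have h4 : ∑ j ∈ Finset.range k, N j ≤ SN := by
        apply Finset.sum_le_sum_of_subset_of_nonneg
        · exact Finset.range_mono (Finset.mem_range.1 hk).le
        · exact fun j _ _ => hN0 j
      have h5 : 5 * q ^ 2 / r * ∑ j ∈ Finset.range k, N j ≤ 5 * q ^ 2 / r * SN := by gcongr
      linarith
    have := Finset.sum_le_card_nsmul _ _ _ this
    simpa using this
  have hFt : ∀ k, F k + η / 2 * (∑ j ∈ Finset.range k, G j)
      + η / 2 * (1 - q) * (∑ j ∈ Finset.range k, N j)
      ≤ F 0 + η / 2 * ∑ j ∈ Finset.range k, V j := by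
    intro k
    induction k with
    | zero => simp
    | succ k ih =>
      rw [Finset.sum_range_succ, Finset.sum_range_succ, Finset.sum_range_succ]
      have := hF k
      rw [← hq] at this
      linarith
  have hmain : SG + (1 - q) * SN ≤ A' + SV := by
    have h1 := hFt K
    have h2 := hF0 K
    have h3 : η / 2 * (SG + (1 - q) * SN) ≤ (F 0 - fstar) + η / 2 * SV := by linarith
    have h4 := mul_le_mul_of_nonneg_left h3 (by positivity : 0 ≤ 2 / η)
    have e1 : 2 / η * (η / 2 * (SG + (1 - q) * SN)) = SG + (1 - q) * SN := by field_simp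
    have e2 : 2 / η * ((F 0 - fstar) + η / 2 * SV) = A' + SV := by rw [hA]; field_simp
    rwa [e1, e2] at h4
  have hNs : 2 / 5 * SG ≤ SN + 2 / 3 * SV := by
    rw [hSG, hSN, hSV, Finset.mul_sum, Finset.mul_sum, ← Finset.sum_add_distrib]
    exact Finset.sum_le_sum fun k _ => hN k
  have hXe : 8 * r / 7 * X = 8 * r / 7 * W + 40 / 7 * q ^ 2 * SN := by
    rw [hX]; field_simp; ring
  constructor
  · have : 40 / 7 * q ^ 2 ≤ 1 - q := by nlinarith
    have := mul_le_mul_of_nonneg_right this hSNn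
    linarith
  · set m := min (K : ℝ) (8 * r / 7) with hm
    have hm0 : 0 ≤ m := by positivity
    have hSVm : SV ≤ m * X := by
      rcases min_choice (K : ℝ) (8 * r / 7) with h | h
      · rw [hm, h]; exact hb2
      · rw [hm, h]; exact hb1
    have hm8 : m ≤ 8 * r / 7 := min_le_right _ _
    have h1 : m * X ≤ m * W + 40 / 7 * q ^ 2 * SN := by
      have : m * (5 * q ^ 2 / r * SN) ≤ 8 * r / 7 * (5 * q ^ 2 / r * SN) := by gcongr
      have e : 8 * r / 7 * (5 * q ^ 2 / r * SN) = 40 / 7 * q ^ 2 * SN := by field_simp; ring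
      rw [hX, mul_add]
      linarith
    have h2 : 20 / 3 * q ^ 2 ≤ 3 / 4 - q := by nlinarith
    have := mul_le_mul_of_nonneg_right h2 hSNn
    linarith

theorem poly_ineq (τ : ℝ) (h0 : 0 ≤ τ) (h1 : τ ≤ 1) :
    7 / 6 * ((1 - τ) * (τ + τ ^ 2 / 2)) - 1 / 10 ≤ 7 / 8 * (1 - τ) := by
  nlinarith [mul_nonneg h0 (sq_nonneg (τ - 77 / 100)), sq_nonneg (τ - 77 / 100), sq_nonneg (τ - 4 / 5),
    mul_nonneg (sub_nonneg.2 h1) (sq_nonneg (τ - 77 / 100))]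

theorem Mop_succ_mono {d n : ℕ} (f : Fin n → EuclideanSpace ℝ (Fin d) → ℝ)
    (η lam : ℕ → ℝ) (b : ℕ → ℕ) (x0 : EuclideanSpace ℝ (Fin d)) (k : ℕ)
    {h h' : EuclideanSpace ℝ (Fin d) × EuclideanSpace ℝ (Fin d) ×
      EuclideanSpace ℝ (Fin d) × (Fin n → EuclideanSpace ℝ (Fin d)) → ℝ}
    (hh : ∀ st I, h (zsStep f (η k) (lam k) (b k) st I) ≤ h' (zsStep f (η k) (lam k) (b k) st I)) :
    Mop f η lam b x0 (k + 1) h ≤ Mop f η lam b x0 (k + 1) h' := by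
  rw [Mop_succ, Mop_succ]
  exact Mop_mono _ _ _ _ _ _ fun st => avI_mono fun I _ => hh st I

theorem Mop_prev {d n : ℕ} (f : Fin n → EuclideanSpace ℝ (Fin d) → ℝ)
    (η lam : ℕ → ℝ) (b : ℕ → ℕ) (x0 : EuclideanSpace ℝ (Fin d)) (k : ℕ) (hb : ∀ k, b k ≤ n)
    (h : EuclideanSpace ℝ (Fin d) → ℝ) :
    Mop f η lam b x0 (k + 1) (fun st => h st.2.1) = Mop f η lam b x0 k (fun st => h st.1) := by
  rw [Mop_succ]
  simp only [zsStep, avI_const (hb k)]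

theorem zs_core {d n r : ℕ} (hr2 : 2 ≤ r)
    (hr : n = r ^ 2)
    (L : ℝ) (hL : 0 < L)
    (f : Fin n → EuclideanSpace ℝ (Fin d) → ℝ)
    (hdiff : ∀ i, Differentiable ℝ (f i))
    (hsmooth : ∀ i (x y : EuclideanSpace ℝ (Fin d)),
      ‖gradient (f i) x - gradient (f i) y‖ ≤ L * ‖x - y‖)
    (x0 : EuclideanSpace ℝ (Fin d))
    (fstar : ℝ) (hfstar : ∀ x, fstar ≤ avgF f x)
    (η lam : ℕ → ℝ) (b : ℕ → ℕ)
    (hη : ∀ k, η k = 1 / ((1 + Real.sqrt 8) * L))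
    (hb01 : 1 ≤ b 0) (hb0n : b 0 ≤ n)
    (hbk : ∀ k, 1 ≤ k → b k = r)
    (hlam0 : lam 0 = 1) (hlamk : ∀ k, 1 ≤ k → lam k = 1 / (2 * (r : ℝ))) (G0 W A' : ℝ)
    (hG0 : G0 = (n : ℝ)⁻¹ * ∑ i, ‖gradient (f i) x0‖ ^ 2)
    (hW : W = ((n : ℝ) - b 0) / ((n - 1) * b 0) * G0 + (1 - (b 0 : ℝ) / n) * G0 / (2 * (r : ℝ) ^ 2))
    (hA : A' = 2 * (1 + Real.sqrt 8) * L * (avgF f x0 - fstar)) (K : ℕ) :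
    (∑ k ∈ Finset.range K,
          zsExpK b k (fun ω => ‖gradient (avgF f) ((zsState f η lam b x0 ω k).1)‖ ^ 2)
        ≤ A' + 8 * (r : ℝ) / 7 * W) ∧
    (11 / 10 * ∑ k ∈ Finset.range K,
          zsExpK b k (fun ω => ‖gradient (avgF f) ((zsState f η lam b x0 ω k).1)‖ ^ 2)
        ≤ A' + 7 / 6 * (min (K : ℝ) (8 * (r : ℝ) / 7) * W)) := by
  have hn : 2 ≤ n := by rw [hr]; nlinarith
  have hrn : r ≤ n := by rw [hr]; nlinarith
  have hbn : ∀ k, b k ≤ n := by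
    intro k
    rcases Nat.eq_zero_or_pos k with h | h
    · rw [h]; exact hb0n
    · rw [hbk k h]; exact hrn
  have hr0 : (2 : ℝ) ≤ r := by exact_mod_cast hr2
  set e : ℝ := 1 / ((1 + Real.sqrt 8) * L) with he
  have he0 : 0 < e := by positivity
  have hs8 : Real.sqrt 8 ^ 2 = 8 := Real.sq_sqrt (by norm_num)
  set q : ℝ := e * L with hq
  have hq' : q = 1 / (1 + Real.sqrt 8) := by rw [hq, he]; field_simp
  have hq0 : 0 < q := by positivity
  have hq1 : 7 * q ^ 2 + 2 * q - 1 = 0 := by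
    rw [hq']
    have : 0 < 1 + Real.sqrt 8 := by positivity
    field_simp
    linear_combination - hs8
  set φV : EuclideanSpace ℝ (Fin d) × EuclideanSpace ℝ (Fin d) ×
      EuclideanSpace ℝ (Fin d) × (Fin n → EuclideanSpace ℝ (Fin d)) → ℝ :=
    fun st => ‖st.2.2.1 - gradient (avgF f) st.2.1‖ ^ 2 with hφV
  set φY : EuclideanSpace ℝ (Fin d) × EuclideanSpace ℝ (Fin d) ×
      EuclideanSpace ℝ (Fin d) × (Fin n → EuclideanSpace ℝ (Fin d)) → ℝ :=
    fun st => (n : ℝ)⁻¹ * ∑ i, ‖gradient (f i) st.2.1 - st.2.2.2 i‖ ^ 2 with hφY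
  set φN : EuclideanSpace ℝ (Fin d) × EuclideanSpace ℝ (Fin d) ×
      EuclideanSpace ℝ (Fin d) × (Fin n → EuclideanSpace ℝ (Fin d)) → ℝ :=
    fun st => ‖st.2.2.1‖ ^ 2 with hφN
  set φD : EuclideanSpace ℝ (Fin d) × EuclideanSpace ℝ (Fin d) ×
      EuclideanSpace ℝ (Fin d) × (Fin n → EuclideanSpace ℝ (Fin d)) → ℝ :=
    fun st => ‖st.1 - st.2.1‖ ^ 2 with hφD
  have nonneg : ∀ k h, (∀ st, 0 ≤ h st) → 0 ≤ Mop f η lam b x0 k h := by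
    intro k h hh
    rw [← Mop_const f η lam b x0 k hbn 0]
    exact Mop_mono _ _ _ _ _ _ hh
  have hD : ∀ k, Mop f η lam b x0 (k + 1) φD = e ^ 2 * Mop f η lam b x0 (k + 1) φN := by
    intro k
    rw [← Mop_smul, Mop_succ, Mop_succ]
    congr 1
    funext st
    congr 1
    funext I
    simp only [hφD, hφN, zsStep, hη]
    rw [sub_sub_cancel_left, norm_neg, norm_smul, mul_pow, Real.norm_eq_abs, sq_abs]
  have key := seq_main r hr0 q e L A' fstar he0 hq hq1 hq0
    (fun k => Mop f η lam b x0 (k + 1) φV) (fun k => Mop f η lam b x0 (k + 1) φY)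
    (fun k => Mop f η lam b x0 (k + 1) φN)
    (fun k => Mop f η lam b x0 k (fun st => ‖gradient (avgF f) st.1‖ ^ 2))
    (fun k => Mop f η lam b x0 k (fun st => avgF f st.1))
    (fun k => nonneg _ _ fun st => by simp only [hφV]; positivity)
    (fun k => nonneg _ _ fun st => by simp only [hφY]; positivity)
    (fun k => nonneg _ _ fun st => by simp only [hφN]; positivity)
    (by
      intro k
      rw [← Mop_const f η lam b x0 k hbn fstar]
      exact Mop_mono _ _ _ _ _ _ fun st => hfstar st.1)
    (by
      simp only [Mop_zero]
      rw [hA, he]; field_simp)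
    (by
      intro k
      beta_reduce
      rw [← Mop_prev f η lam b x0 k hbn (fun x => ‖gradient (avgF f) x‖ ^ 2),
        ← Mop_prev f η lam b x0 k hbn (fun x => avgF f x)]
      simp only [← Mop_smul, ← Mop_add]
      apply Mop_succ_mono
      intro st I
      simp only [zsStep, hη, hφN, hφV]
      exact F_step hn L f hdiff hsmooth st.1 _ e)
    (by
      intro k
      rw [← hD k, ← Mop_smul, ← Mop_smul, ← Mop_smul, ← Mop_add, ← Mop_add, Mop_succ]
      apply Mop_mono
      intro st
      rw [hbk (k + 1) (by omega), hlamk (k + 1) (by omega)]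
      exact V_step' hr2 hr L f hdiff hsmooth _ st)
    (by
      intro k
      rw [← hD k, ← Mop_smul, ← Mop_smul, ← Mop_add, Mop_succ]
      apply Mop_mono
      intro st
      rw [hbk (k + 1) (by omega)]
      exact Y_step' hr2 hr L f hsmooth _ _ st)
    (by
      intro k
      beta_reduce
      rw [← Mop_prev f η lam b x0 k hbn (fun x => ‖gradient (avgF f) x‖ ^ 2)]
      rw [← Mop_smul, ← Mop_smul, ← Mop_add]
      apply Mop_mono
      intro st
      exact N_lower _ _) K
  have hV0 : Mop f η lam b x0 (0 + 1) φV ≤ ((n : ℝ) - b 0) / ((n - 1) * b 0) * G0 := by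
    rw [Mop_succ, Mop_zero, hlam0]
    refine (V_step hn f hdiff _ _ _ hb01 hb0n _).trans (le_of_eq ?_)
    simp [hG0]
  have hY0 : Mop f η lam b x0 (0 + 1) φY = (1 - (b 0 : ℝ) / n) * G0 := by
    rw [Mop_succ, Mop_zero]
    refine (Y_step f _ _ _ hb01 hb0n _).trans ?_
    simp [hG0]
  have hWW : Mop f η lam b x0 (0 + 1) φV + Mop f η lam b x0 (0 + 1) φY / (2 * (r : ℝ) ^ 2) ≤ W := by
    rw [hW, hY0]
    linarith
  refine ⟨key.1.trans ?_, key.2.trans ?_⟩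
  · gcongr
  · gcongr


set_option maxHeartbeats 1000000

/-- Corollary 3 (ZeroSARAH with improved initial minibatch
`b₀ = min{⌈√(n G₀)/ε⌉, n}`, `bₖ = √n` for `k ≥ 1`);
here `G₀ = (1/n)∑ᵢ‖∇fᵢ(x⁰)‖² > 0`. -/
theorem zerosarah_corollary3 {d n r : ℕ} (hd : 1 ≤ d) (hn : 2 ≤ n)
    (hr : n = r ^ 2)
    (L : ℝ) (hL : 0 < L)
    (f : Fin n → EuclideanSpace ℝ (Fin d) → ℝ)
    (hdiff : ∀ i, Differentiable ℝ (f i))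
    (hsmooth : ∀ i (x y : EuclideanSpace ℝ (Fin d)),
      ‖gradient (f i) x - gradient (f i) y‖ ≤ L * ‖x - y‖)
    (x0 : EuclideanSpace ℝ (Fin d))
    (fstar : ℝ) (hfstar : IsGLB (Set.range (avgF f)) fstar)
    (hG0pos : 0 < (n : ℝ)⁻¹ * ∑ i, ‖gradient (f i) x0‖ ^ 2)
    (ε : ℝ) (hε : 0 < ε)
    (η lam : ℕ → ℝ) (b : ℕ → ℕ)
    (hη : ∀ k, η k = 1 / ((1 + Real.sqrt 8) * L))
    (hb0 : b 0 = min
      ⌈Real.sqrt ((n : ℝ) * ((n : ℝ)⁻¹ * ∑ i, ‖gradient (f i) x0‖ ^ 2)) / ε⌉₊ n)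
    (hbk : ∀ k, 1 ≤ k → b k = r)
    (hlam0 : lam 0 = 1) (hlamk : ∀ k, 1 ≤ k → lam k = 1 / (2 * (r : ℝ))) :
    (∀ K : ℕ, 1 ≤ K →
      (K : ℝ)⁻¹ * ∑ k ∈ Finset.range K,
          zsExpK b k (fun ω => ‖gradient (avgF f) ((zsState f η lam b x0 ω k).1)‖ ^ 2)
        ≤ (2 * (1 + Real.sqrt 8) * L * (avgF f x0 - fstar)
            + 6 * ((n : ℝ) - (b 0 : ℝ))
              * ((n : ℝ)⁻¹ * ∑ i, ‖gradient (f i) x0‖ ^ 2)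
              / ((r : ℝ) * (b 0 : ℝ))) / (K : ℝ))
    ∧ (∃ K : ℕ, 1 ≤ K ∧
        (K : ℝ)⁻¹ * ∑ k ∈ Finset.range K,
            zsExpK b k (fun ω => ‖gradient (avgF f) ((zsState f η lam b x0 ω k).1)‖ ^ 2)
          ≤ ε ^ 2
        ∧ (b 0 : ℝ) + ((K : ℝ) - 1) * (r : ℝ)
          ≤ (r : ℝ) * (2 * (1 + Real.sqrt 8) * L * (avgF f x0 - fstar) / ε ^ 2
              + min (7 * Real.sqrt ((n : ℝ)⁻¹ * ∑ i, ‖gradient (f i) x0‖ ^ 2) / ε)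
                  (r : ℝ))
            + 2 * (r : ℝ)) := by
  have hr2 : 2 ≤ r := by
    by_contra h
    have : r ≤ 1 := by omega
    have : r ^ 2 ≤ 1 := by nlinarith
    omega
  have hrR : (2 : ℝ) ≤ r := by exact_mod_cast hr2
  have hr0 : (0 : ℝ) < r := by linarith
  have hnr : (n : ℝ) = (r : ℝ) ^ 2 := by rw [hr]; push_cast; rfl
  have hn4 : (4 : ℝ) ≤ n := by rw [hnr]; nlinarith
  have hn0 : (0 : ℝ) < n := by linarith
  have hn1 : (0 : ℝ) < (n : ℝ) - 1 := by linarith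
  obtain ⟨G0, hG0⟩ : ∃ G0, G0 = (n : ℝ)⁻¹ * ∑ i, ‖gradient (f i) x0‖ ^ 2 := ⟨_, rfl⟩
  rw [← hG0] at hG0pos hb0 ⊢
  set A' : ℝ := 2 * (1 + Real.sqrt 8) * L * (avgF f x0 - fstar) with hA'
  have hlow : ∀ x, fstar ≤ avgF f x := fun x => hfstar.1 ⟨x, rfl⟩
  have hA0 : 0 ≤ A' := by
    have := hlow x0
    have : 0 ≤ avgF f x0 - fstar := by linarith
    positivity
  -- s = √G₀ / ε
  set s : ℝ := Real.sqrt G0 / ε with hs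
  have hs0 : 0 < s := div_pos (Real.sqrt_pos.2 hG0pos) hε
  have hGs : G0 = s ^ 2 * ε ^ 2 := by
    rw [hs, div_pow, Real.sq_sqrt hG0pos.le]; field_simp
  have hsq : Real.sqrt ((n : ℝ) * G0) / ε = r * s := by
    rw [hnr, Real.sqrt_mul (by positivity), Real.sqrt_sq hr0.le, hs]; ring
  rw [hsq] at hb0
  have hceil : 1 ≤ ⌈(r : ℝ) * s⌉₊ := Nat.one_le_iff_ne_zero.2 (Nat.ceil_pos.2 (by positivity)).ne'
  have hb01 : 1 ≤ b 0 := by rw [hb0]; exact le_min hceil (by omega)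
  have hb0n : b 0 ≤ n := by rw [hb0]; exact min_le_right _ _
  obtain ⟨B, hB⟩ : ∃ B : ℝ, B = (b 0 : ℝ) := ⟨_, rfl⟩
  have hB1 : 1 ≤ B := by rw [hB]; exact_mod_cast hb01
  have hBn : B ≤ n := by rw [hB]; exact_mod_cast hb0n
  have hBup : B ≤ r * s + 1 := by
    have h1 : b 0 ≤ ⌈(r : ℝ) * s⌉₊ := by rw [hb0]; exact min_le_left _ _
    have h2 : (b 0 : ℝ) ≤ (⌈(r : ℝ) * s⌉₊ : ℝ) := by exact_mod_cast h1
    have h3 := (Nat.ceil_lt_add_one (by positivity : 0 ≤ (r : ℝ) * s)).le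
    rw [hB]; linarith
  have hBlo : r * s ≤ B ∨ B = n := by
    rcases min_choice ⌈(r : ℝ) * s⌉₊ n with h | h
    · left
      rw [hB, hb0, h]; exact Nat.le_ceil _
    · right
      rw [hB, hb0, h]
  have core := fun K => zs_core hr2 hr L hL f hdiff hsmooth x0 fstar hlow η lam b hη hb01 hb0n hbk
    hlam0 hlamk G0 _ A' hG0 rfl hA' K
  rw [← hB] at core ⊢
  set S : ℕ → ℝ := fun K => ∑ k ∈ Finset.range K,
    zsExpK b k (fun ω => ‖gradient (avgF f) ((zsState f η lam b x0 ω k).1)‖ ^ 2) with hS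
  set W : ℝ := ((n : ℝ) - B) / ((n - 1) * B) * G0 + (1 - B / n) * G0 / (2 * (r : ℝ) ^ 2) with hW
  have hnB : 0 ≤ (n : ℝ) - B := by linarith
  have hpart1 : ∀ K, S K ≤ A' + 6 * ((n : ℝ) - B) * G0 / ((r : ℝ) * B) := by
    intro K
    refine (core K).1.trans ?_
    have e : 6 * ((n : ℝ) - B) * G0 / ((r : ℝ) * B) - 8 * (r : ℝ) / 7 * W
      = (((n : ℝ) - B) * G0 / ((r : ℝ) * B)) * (6 - 8 / 7 * ((n : ℝ) / (n - 1) + B / (2 * n))) := by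
      rw [hW, hnr]
      have : (r : ℝ) ^ 2 - 1 ≠ 0 := by rw [← hnr]; exact hn1.ne'
      field_simp
    have h1 : (n : ℝ) / (n - 1) ≤ 2 := by rw [div_le_iff₀ hn1]; linarith
    have h2 : B / (2 * n) ≤ 1 := by rw [div_le_one (by positivity)]; linarith
    have h3 : 0 ≤ (((n : ℝ) - B) * G0 / ((r : ℝ) * B)) := by positivity
    have h4 : 0 ≤ (6 - 8 / 7 * ((n : ℝ) / (n - 1) + B / (2 * n))) := by linarith
    have := mul_nonneg h3 h4
    linarith
  refine ⟨?_, ?_⟩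
  · intro K hK
    have hK0 : (0 : ℝ) < K := by exact_mod_cast hK
    rw [inv_mul_eq_div]
    gcongr
    exact hpart1 K
  have hfin : ∀ K : ℕ, 1 ≤ K → S K ≤ K * ε ^ 2 → (K : ℝ)⁻¹ * S K ≤ ε ^ 2 := by
    intro K hK h
    have hK0 : (0 : ℝ) < K := by exact_mod_cast hK
    rw [inv_mul_eq_div, div_le_iff₀ hK0]
    linarith
  have hseq : 7 * Real.sqrt G0 / ε = 7 * s := by rw [hs]; ring
  rw [hseq]
  obtain ⟨A, hA⟩ : ∃ A, A = A' / ε ^ 2 := ⟨_, rfl⟩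
  have hAA : A' = A * ε ^ 2 := by rw [hA]; field_simp
  have hAn : 0 ≤ A := by rw [hA]; positivity
  rw [← hA]
  rcases le_or_gt (7 * s) r with hc | hc
  · -- small gradient: use the first part
    have hBlo' : r * s ≤ B := by
      rcases hBlo with h | h
      · exact h
      · rw [h, hnr]; nlinarith
    obtain ⟨K, hK⟩ : ∃ K : ℕ, K = max 1 ⌈A + 6 * s⌉₊ := ⟨_, rfl⟩
    have hK1 : 1 ≤ K := by rw [hK]; exact le_max_left _ _
    have hKlo : A + 6 * s ≤ K := by
      have h1 : ⌈A + 6 * s⌉₊ ≤ K := by rw [hK]; exact le_max_right _ _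
      exact (Nat.le_ceil _).trans (by exact_mod_cast h1)
    have hKup : (K : ℝ) - 1 ≤ A + 6 * s := by
      rcases max_choice 1 ⌈A + 6 * s⌉₊ with h | h
      · rw [hK, h]; push_cast; linarith
      · rw [hK, h]
        have := (Nat.ceil_lt_add_one (by positivity : 0 ≤ A + 6 * s)).le
        linarith
    refine ⟨K, hK1, hfin K hK1 ?_, ?_⟩
    · refine (hpart1 K).trans ?_
      have h1 : 6 * ((n : ℝ) - B) * G0 / ((r : ℝ) * B) ≤ 6 * s * ε ^ 2 := by
        rw [div_le_iff₀ (by positivity), hGs, hnr]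
        have h2 : ((r : ℝ) ^ 2 - B) * s ≤ r * B := by nlinarith
        have h3 : 0 ≤ 6 * s * ε ^ 2 := by positivity
        have := mul_le_mul_of_nonneg_left h2 h3
        linarith
      have h2 := mul_le_mul_of_nonneg_right hKlo (sq_nonneg ε)
      linarith
    · rw [min_eq_left hc]
      have := mul_le_mul_of_nonneg_right hKup hr0.le
      linarith
  · obtain ⟨K, hK⟩ : ∃ K : ℕ, K = ⌊A + ((n : ℝ) - B) / r + 3⌋₊ := ⟨_, rfl⟩
    have hx0 : 0 ≤ ((n : ℝ) - B) / r := by positivity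
    have hKlo : A + ((n : ℝ) - B) / r + 2 ≤ K := by
      have := Nat.lt_floor_add_one (A + ((n : ℝ) - B) / r + 3)
      rw [← hK] at this
      linarith
    have hKup : (K : ℝ) ≤ A + ((n : ℝ) - B) / r + 3 := by
      rw [hK]; exact Nat.floor_le (by positivity)
    have hK1 : 1 ≤ K := by
      have : (1 : ℝ) ≤ K := by linarith
      exact_mod_cast this
    refine ⟨K, hK1, hfin K hK1 ?_, ?_⟩
    · have h := (core K).2
      change 11 / 10 * S K ≤ _ at h
      obtain ⟨m, hm⟩ : ∃ m, m = min (K : ℝ) (8 * (r : ℝ) / 7) := ⟨_, rfl⟩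
      rw [← hm] at h
      have hmK : m ≤ K := by rw [hm]; exact min_le_left _ _
      have hmr : m ≤ 8 * r / 7 := by rw [hm]; exact min_le_right _ _
      have hm0 : 0 ≤ m := by rw [hm]; positivity
      obtain ⟨τ, hτ⟩ : ∃ τ, τ = B / n := ⟨_, rfl⟩
      have hBτ : B = n * τ := by rw [hτ]; field_simp
      have hτ0 : 0 < τ := by rw [hτ]; positivity
      have hτ1 : τ ≤ 1 := by rw [hτ, div_le_one hn0]; exact hBn
      have hGB : ((n : ℝ) - B) * G0 ≤ ((n : ℝ) - B) * (ε ^ 2 * (n * τ ^ 2)) := by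
        rcases hBlo with h | h
        · apply mul_le_mul_of_nonneg_left _ hnB
          rw [hGs, mul_comm]
          apply mul_le_mul_of_nonneg_left _ (sq_nonneg ε)
          rw [hBτ, hnr] at h
          have h5 : s ≤ r * τ := by
            have : (r : ℝ) * s ≤ r * (r * τ) := by linarith
            exact le_of_mul_le_mul_left this hr0
          calc s ^ 2 ≤ (r * τ) ^ 2 := by gcongr
            _ = _ := by rw [hnr]; ring
        · rw [h]; simp
      have hWb : W ≤ ε ^ 2 * ((1 - τ) * (τ + τ ^ 2 / 2) + 1 / (4 * ((n : ℝ) - 1))) := by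
        have e1 : W = (((n : ℝ) - B) * G0) * (1 / ((n - 1) * B) + 1 / (2 * n ^ 2)) := by
          rw [hW, ← hnr]; field_simp
        have e2 : (((n : ℝ) - B) * (ε ^ 2 * (n * τ ^ 2))) * (1 / ((n - 1) * B) + 1 / (2 * n ^ 2))
          = ε ^ 2 * ((1 - τ) * (τ + τ ^ 2 / 2) + (1 - τ) * τ / (n - 1)) := by
          rw [hBτ]; field_simp; ring
        rw [e1]
        refine (mul_le_mul_of_nonneg_right hGB (by positivity)).trans ?_
        rw [e2]
        have h7 : (1 - τ) * τ / ((n : ℝ) - 1) ≤ 1 / (4 * ((n : ℝ) - 1)) := by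
          rw [div_le_div_iff₀ hn1 (by positivity)]
          have := mul_nonneg hn1.le (sq_nonneg (2 * τ - 1))
          linarith
        apply mul_le_mul_of_nonneg_left _ (sq_nonneg ε)
        linarith
      have hpoly := mul_le_mul_of_nonneg_left (poly_ineq τ hτ0.le hτ1) hm0
      have hx : ((n : ℝ) - B) / r = r * (1 - τ) := by
        rw [hBτ, hnr]; field_simp
      have h1 : m * (7 / 8 * (1 - τ)) ≤ r * (1 - τ) := by
        have := mul_le_mul_of_nonneg_right hmr (by linarith : 0 ≤ 7 / 8 * (1 - τ))
        linarith
      have h2 : 7 / 6 * (m * (1 / (4 * ((n : ℝ) - 1)))) ≤ 2 := by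
        have : m * (1 / (4 * ((n : ℝ) - 1))) ≤ 1 := by
          rw [mul_one_div, div_le_one (by positivity), hnr]
          have h8 : 2 * (r : ℝ) ≤ (r : ℝ) ^ 2 := by
            rw [sq]; exact mul_le_mul_of_nonneg_right hrR hr0.le
          linarith
        linarith
      have h3 : A + 7 / 6 * (m * ((1 - τ) * (τ + τ ^ 2 / 2) + 1 / (4 * ((n : ℝ) - 1))))
          ≤ 11 / 10 * K := by
        rw [hx] at hKlo
        linarith
      have h4 := mul_le_mul_of_nonneg_left hWb hm0
      have h5 := mul_le_mul_of_nonneg_left h3 (sq_nonneg ε)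
      rw [hAA] at h
      linarith
    · rw [min_eq_right hc.le]
      have h1 := mul_le_mul_of_nonneg_right hKup hr0.le
      have h2 : (A + ((n : ℝ) - B) / r + 3) * r = A * r + (n - B) + 3 * r := by field_simp
      rw [h2] at h1
      rw [hnr] at h1
      linarith
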